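/- Let Q be a finite set of points in ℝ^d and let T be a Euclidean minimum spanning tree of the complete graph K_Q (edges weighted by Euclidean distance). If pq and pr are two distinct edges of T sharing the endpoint p (so q ≠ r), then the angle between the vectors q − p and r − p is at least π/3. -/

import Mathlib

open scoped NNReal

noncomputable section

/-- Euclidean length of an edge of the complete graph on the point set `Q` in `ℝ^d`. -/
def edgeLen {d : ℕ} (Q : Finset (EuclideanSpace ℝ (Fin d))) : Sym2 {x // x ∈ Q} → ℝ≥0 :=
  Sym2.lift ⟨fun x y => nndist (x : EuclideanSpace ℝ (Fin d)) (y : EuclideanSpace ℝ (Fin d)),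
    fun _ _ => nndist_comm _ _⟩

/-- Total Euclidean edge length of a spanning subgraph `T` of the complete graph `K_Q`. -/
def totalWeight {d : ℕ} (Q : Finset (EuclideanSpace ℝ (Fin d)))
    (T : SimpleGraph {x // x ∈ Q}) : ℝ≥0 :=
  ∑ e ∈ (Set.toFinite T.edgeSet).toFinset, edgeLen Q e

namespace SimpleGraph

variable {V : Type*} {G H : SimpleGraph V}

lemma Reachable.of_forall_adj (h : ∀ ⦃u v⦄, G.Adj u v → H.Reachable u v) {u v : V}
    (huv : G.Reachable u v) : H.Reachable u v := by
  obtain ⟨w⟩ := huv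
  induction w with
  | nil => exact Reachable.refl _
  | cons hadj _ ih => exact (h hadj).trans ih

/-- Two edges `pq`, `pr` of a tree: `q` and `r` are separated by deleting `pq`. -/
lemma IsTree.not_reachable_deleteEdges {p q r : V} (hG : G.IsTree) (hpq : G.Adj p q)
    (hpr : G.Adj p r) (hqr : q ≠ r) : ¬ (G.deleteEdges {s(p, q)}).Reachable q r := by
  intro h
  have hb := isAcyclic_iff_forall_adj_isBridge.mp hG.isAcyclic hpq
  rw [isBridge_iff] at hb
  have hpr' : (G.deleteEdges {s(p, q)}).Adj p r := by
    simp [deleteEdges_adj, hpr, hqr.symm, hpq.ne]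
  exact hb (hpr'.reachable.trans h.symm)

/-- In a tree, the edge `pq` may be exchanged for `qr` whenever `pr` is another edge. -/
lemma IsTree.deleteEdges_sup_edge {p q r : V} (hG : G.IsTree) (hpq : G.Adj p q)
    (hpr : G.Adj p r) (hqr : q ≠ r) : (G.deleteEdges {s(p, q)} ⊔ edge q r).IsTree := by
  have hr : (G.deleteEdges {s(p, q)} ⊔ edge q r).Reachable p q := by
    have h₁ : (G.deleteEdges {s(p, q)} ⊔ edge q r).Adj p r := by
      left; simp [deleteEdges_adj, hpr, hqr.symm, hpq.ne]
    have h₂ : (G.deleteEdges {s(p, q)} ⊔ edge q r).Adj r q := by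
      right; simp [edge_adj, hqr.symm]
    exact h₁.reachable.trans h₂.reachable
  have hG' := hG.isAcyclic.anti (deleteEdges_le (G := G) {s(p, q)})
  have := hG.connected.nonempty
  refine ⟨⟨fun u v => (hG.connected.preconnected u v).of_forall_adj fun a b hab => ?_⟩,
    hG'.sup_edge_of_not_reachable (hG.not_reachable_deleteEdges hpq hpr hqr)⟩
  by_cases he : s(a, b) = s(p, q)
  · rcases Sym2.eq_iff.mp he with ⟨rfl, rfl⟩ | ⟨rfl, rfl⟩
    exacts [hr, hr.symm]
  · exact Adj.reachable (Or.inl (by simpa [deleteEdges_adj, hab] using he))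

end SimpleGraph

/-- Exchanging the edge `pq` for `qr` does not decrease the weight of a minimum spanning tree. -/
lemma dist_le_dist_of_forall_totalWeight_le {d : ℕ} {Q : Finset (EuclideanSpace ℝ (Fin d))}
    {T : SimpleGraph {x // x ∈ Q}} (hT : T.IsTree)
    (hMST : ∀ T' : SimpleGraph {x // x ∈ Q}, T'.IsTree → totalWeight Q T ≤ totalWeight Q T')
    {p q r : {x // x ∈ Q}} (hpq : T.Adj p q) (hpr : T.Adj p r) (hqr : q ≠ r) :
    dist (p : EuclideanSpace ℝ (Fin d)) q ≤ dist (q : EuclideanSpace ℝ (Fin d)) r := by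
  classical
  have hle := hMST _ (hT.deleteEdges_sup_edge hpq hpr hqr)
  have hnot : s(q, r) ∉ (Set.toFinite T.edgeSet).toFinset.erase s(p, q) := by
    intro h
    have hadj : (T.deleteEdges {s(p, q)}).Adj q r := by
      rw [Finset.mem_erase, Set.Finite.mem_toFinset] at h
      exact (SimpleGraph.deleteEdges_adj).mpr ⟨h.2, h.1⟩
    exact hT.not_reachable_deleteEdges hpq hpr hqr hadj.reachable
  have hT' : (Set.toFinite (T.deleteEdges {s(p, q)} ⊔ SimpleGraph.edge q r).edgeSet).toFinset =
      insert s(q, r) ((Set.toFinite T.edgeSet).toFinset.erase s(p, q)) := by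
    ext e
    simp [SimpleGraph.edgeSet_deleteEdges, SimpleGraph.edgeSet_edge_of_ne hqr, and_comm]
  have hmem : s(p, q) ∈ (Set.toFinite T.edgeSet).toFinset := by simpa using hpq
  rw [totalWeight, totalWeight, hT', Finset.sum_insert hnot,
    ← Finset.add_sum_erase _ _ hmem, add_le_add_iff_right] at hle
  exact_mod_cast hle

/-- An angle opposite to a longest side of a triangle is at least `π / 3`. -/
lemma InnerProductGeometry.pi_div_three_le_angle_of_norm_le {E : Type*} [NormedAddCommGroup E]
    [InnerProductSpace ℝ E] {u v : E} (hu : u ≠ 0) (hv : v ≠ 0) (hu' : ‖u‖ ≤ ‖u - v‖)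
    (hv' : ‖v‖ ≤ ‖u - v‖) : Real.pi / 3 ≤ angle u v := by
  by_contra! hlt
  have hcos : 1 / 2 < Real.cos (angle u v) := by
    rw [← Real.cos_pi_div_three]
    exact Real.cos_lt_cos_of_nonneg_of_le_pi (angle_nonneg u v)
      (by linarith [Real.pi_pos]) hlt
  have hlaw := norm_sub_sq_eq_norm_sq_add_norm_sq_sub_two_mul_norm_mul_norm_mul_cos_angle u v
  have hu0 := norm_pos_iff.mpr hu
  have hv0 := norm_pos_iff.mpr hv
  have hmul := mul_lt_mul_of_pos_left hcos (mul_pos hu0 hv0)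
  rcases le_total ‖u‖ ‖v‖ with h | h <;> nlinarith

/-- If `T` is a Euclidean minimum spanning tree of a finite point set `Q ⊆ ℝ^d` and `pq`, `pr`
are two distinct edges of `T` sharing the endpoint `p`, then the angle between the vectors
`q - p` and `r - p` is at least `π/3`. -/
theorem stmt2 {d : ℕ} (Q : Finset (EuclideanSpace ℝ (Fin d)))
    (T : SimpleGraph {x // x ∈ Q}) (hT : T.IsTree)
    (hMST : ∀ T' : SimpleGraph {x // x ∈ Q}, T'.IsTree → totalWeight Q T ≤ totalWeight Q T')
    (p q r : {x // x ∈ Q}) (hpq : T.Adj p q) (hpr : T.Adj p r) (hqr : q ≠ r) :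
    Real.pi / 3 ≤ InnerProductGeometry.angle
      ((q : EuclideanSpace ℝ (Fin d)) - (p : EuclideanSpace ℝ (Fin d)))
      ((r : EuclideanSpace ℝ (Fin d)) - (p : EuclideanSpace ℝ (Fin d))) := by
  have hq := dist_le_dist_of_forall_totalWeight_le hT hMST hpq hpr hqr
  have hr := dist_le_dist_of_forall_totalWeight_le hT hMST hpr hpq hqr.symm
  rw [dist_comm, dist_eq_norm, dist_eq_norm] at hq
  rw [dist_comm, dist_comm (r : EuclideanSpace ℝ (Fin d)) q, dist_eq_norm, dist_eq_norm] at hr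
  apply InnerProductGeometry.pi_div_three_le_angle_of_norm_le
  · exact sub_ne_zero.mpr (Subtype.coe_ne_coe.mpr hpq.ne')
  · exact sub_ne_zero.mpr (Subtype.coe_ne_coe.mpr hpr.ne')
  · rwa [sub_sub_sub_cancel_right]
  · rwa [sub_sub_sub_cancel_right]

end
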